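/- For all positive integers l, l', s, s', t and every σ ∈ ℕ ∪ {0}, there are positive integers f = f(l,l',s,s',t,σ) and g = g(l,l',s,s',t,σ) with the following property. Let q be a positive integer and let q⁻, q⁺ ∈ ℕ ∪ {0} with q⁻ + q⁺ = σ. Let 𝔟 be an ample and (q⁻,q,q⁺)-mixed (f,g)-constellation. Then one of the following holds: (a) 𝔟 has an induced subgraph isomorphic to a proper subdivision of K_{2t+2}; (b) there is an interrupted (s,l)-constellation which sits in 𝔟; or (c) there is a q-zigzagged (s',l')-constellation which sits in 𝔟. -/

import Mathlib

open SimpleGraph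

/-- Two vertex sets `X` and `Y` are *anticomplete* in `G` if they are disjoint and
there is no edge of `G` with an end in each. -/
def Anticomplete {V : Type} (G : SimpleGraph V) (X Y : Set V) : Prop :=
  Disjoint X Y ∧ ∀ x ∈ X, ∀ y ∈ Y, ¬ G.Adj x y

/-- `G` has an induced subgraph isomorphic to `H`. -/
def HasInducedSubgraphIso {V W : Type} (G : SimpleGraph V) (H : SimpleGraph W) : Prop :=
  ∃ X : Set V, Nonempty (H ≃g G.induce X)

/-- `G` has an induced minor isomorphic to `H`, witnessed by branch sets. -/
def HasInducedMinor {V W : Type} (G : SimpleGraph V) (H : SimpleGraph W) : Prop :=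
  ∃ B : W → Set V,
    (∀ w, (G.induce (B w)).Connected) ∧
    (Pairwise fun u v => Disjoint (B u) (B v)) ∧
    (∀ u v : W, u ≠ v → (H.Adj u v ↔ ¬ Anticomplete G (B u) (B v)))

/-- The set `P` induces a path in `G`. -/
def IsPathSet {V : Type} (G : SimpleGraph V) (P : Set V) : Prop :=
  ∃ n : ℕ, Nonempty (G.induce P ≃g pathGraph (n + 1))

/-- The vertex sets of the connected components of the subgraph of `G` induced on `X`. -/
def CompsOn {V : Type} (G : SimpleGraph V) (X : Set V) : Set (Set V) :=
  {L | ∃ C : (G.induce X).ConnectedComponent, L = Subtype.val '' C.supp}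

/-- The induced subgraph of `G` on `W` together with the stable set `S ⊆ W` forms a
constellation: every component of `W \ S` is a path and every vertex of `S` has a
neighbor in every such component. -/
structure IsConstellationOn {V : Type} (G : SimpleGraph V) (W S : Set V) : Prop where
  subset : S ⊆ W
  stable : ∀ x ∈ S, ∀ y ∈ S, ¬ G.Adj x y
  comp_paths : ∀ L ∈ CompsOn G (W \ S), IsPathSet G L
  dominates : ∀ x ∈ S, ∀ L ∈ CompsOn G (W \ S), ∃ y ∈ L, G.Adj x y

/-- `p` is a route of the constellation `(W, S)` in `G`: an induced path of the induced
subgraph of `G` on `W`, with its two (distinct) ends in `S` and its interior outside `S`. -/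
structure IsRoute {V : Type} (G : SimpleGraph V) (W S : Set V) {x y : V}
    (p : G.Walk x y) : Prop where
  ne : x ≠ y
  isPath : p.IsPath
  induced : ∀ u v, u ∈ p.support → v ∈ p.support → G.Adj u v → p.toSubgraph.Adj u v
  support_mem : ∀ v ∈ p.support, v ∈ W
  fst_mem : x ∈ S
  snd_mem : y ∈ S
  interior : ∀ v ∈ p.support, v ≠ x → v ≠ y → v ∉ S

/-- The constellation `(W, S)` in `G` is `d`-ample: no route has length at most `d+1`. -/
def DAmple {V : Type} (G : SimpleGraph V) (W S : Set V) (d : ℕ) : Prop :=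
  ∀ ⦃x y : V⦄ (p : G.Walk x y), IsRoute G W S p → d + 1 < p.length

/-- The constellation `(W, S)` in `G` is interrupted with respect to some linear order
(encoded by an injective-on-`S` function `f : V → ℕ`). -/
def Interrupted {V : Type} (G : SimpleGraph V) (W S : Set V) : Prop :=
  ∃ f : V → ℕ, Set.InjOn f S ∧
    ∀ x ∈ S, ∀ y ∈ S, ∀ z ∈ S, f x < f y → f y < f z →
      ∀ (p : G.Walk x y), IsRoute G W S p → ∃ v ∈ p.support, G.Adj z v

/-- The constellation `(W, S)` in `G` is `q`-zigzagged. -/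
def Zigzagged {V : Type} (G : SimpleGraph V) (W S : Set V) (q : ℕ) : Prop :=
  ∃ f : V → ℕ, Set.InjOn f S ∧
    ∀ x ∈ S, ∀ y ∈ S, f x < f y →
      ∀ (p : G.Walk x y), IsRoute G W S p →
        {z | z ∈ S ∧ f x < f z ∧ f z < f y ∧ ¬ ∃ v ∈ p.support, G.Adj z v}.ncard < q

/-- The constellation `(W, S)` in `G` is `(qm, q, qp)`-mixed. -/
def Mixed {V : Type} (G : SimpleGraph V) (W S : Set V) (qm q qp : ℕ) : Prop :=
  ∃ f : V → ℕ, Set.InjOn f S ∧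
    ∀ x ∈ S, ∀ y ∈ S, f x < f y →
      ∀ (p : G.Walk x y), IsRoute G W S p →
        ∀ Qm Q Qp : Set V, Qm ⊆ S → Q ⊆ S → Qp ⊆ S →
          Qm.ncard = qm → Q.ncard = q → Qp.ncard = qp →
          (∀ z ∈ Qm, f z < f x) → (∀ z ∈ Q, f x < f z ∧ f z < f y) →
          (∀ z ∈ Qp, f y < f z) →
          ∃ z ∈ Qm ∪ Q ∪ Qp, ∃ v ∈ p.support, G.Adj z v

/-- The constellation `(W', S')` sits in the constellation `(W, S)` (both within `G`). -/
def SitsIn {V : Type} (G : SimpleGraph V) (W' S' W S : Set V) : Prop :=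
  W' ⊆ W ∧ S' ⊆ S ∧
  (∀ L ∈ CompsOn G (W' \ S'), ∃ M ∈ CompsOn G (W \ S), L ⊆ M) ∧
  (∀ M ∈ CompsOn G (W \ S), ∀ L₁ ∈ CompsOn G (W' \ S'), ∀ L₂ ∈ CompsOn G (W' \ S'),
      L₁ ⊆ M → L₂ ⊆ M → L₁ = L₂)

/-- A witness that `S` is a subdivision of `H`, where each edge of `H` is replaced by a
path whose length satisfies `ok`. -/
structure SubdivModel {U W : Type} (S : SimpleGraph U) (H : SimpleGraph W)
    (ok : ℕ → Prop) where
  b : W → U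
  b_inj : Function.Injective b
  path : ∀ ⦃u v : W⦄, H.Adj u v → S.Walk (b u) (b v)
  path_isPath : ∀ ⦃u v : W⦄ (h : H.Adj u v), (path h).IsPath
  path_len : ∀ ⦃u v : W⦄ (h : H.Adj u v), ok (path h).length
  path_symm : ∀ ⦃u v : W⦄ (h : H.Adj u v), path h.symm = (path h).reverse
  branch_avoid : ∀ ⦃u v : W⦄ (h : H.Adj u v) (w : W), b w ∈ (path h).support → w = u ∨ w = v
  interiors_anticomplete :
    ∀ ⦃u v u' v' : W⦄ (h : H.Adj u v) (h' : H.Adj u' v'),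
      (s(u, v) : Sym2 W) ≠ s(u', v') →
      ∀ x ∈ (path h).support, x ≠ b u → x ≠ b v →
      ∀ y ∈ (path h').support, y ≠ b u' → y ≠ b v' →
        x ≠ y ∧ ¬ S.Adj x y
  cover : ∀ x : U, (∃ w, x = b w) ∨ ∃ (u v : W) (h : H.Adj u v), x ∈ (path h).support
  edges_eq : ∀ x y : U, S.Adj x y → ∃ (u v : W) (h : H.Adj u v), (path h).toSubgraph.Adj x y

/-- `S` is a subdivision of `H` with path lengths satisfying `ok`. -/
def IsSubdivisionWith {U W : Type} (S : SimpleGraph U) (H : SimpleGraph W)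
    (ok : ℕ → Prop) : Prop :=
  Nonempty (SubdivModel S H ok)

/-- The line graph of `G`. -/
def LineGraph {V : Type} (G : SimpleGraph V) : SimpleGraph G.edgeSet :=
  SimpleGraph.fromRel (fun e f => ∃ v : V, v ∈ (e : Sym2 V) ∧ v ∈ (f : Sym2 V))

/-- The `r`-by-`r` hexagonal wall (brick wall). -/
def Wall (r : ℕ) : SimpleGraph (Fin r × Fin (2 * r)) :=
  SimpleGraph.fromRel (fun a b =>
    (a.1 = b.1 ∧ a.2.val + 1 = b.2.val) ∨
    (a.2 = b.2 ∧ a.1.val + 1 = b.1.val ∧ (a.1.val + a.2.val) % 2 = 0))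

/-- The full binary tree of radius `r`, on `2^(r+1) - 1` vertices (heap indexing). -/
def BinTree (r : ℕ) : SimpleGraph (Fin (2 ^ (r + 1) - 1)) :=
  SimpleGraph.fromRel (fun a b =>
    b.val + 1 = 2 * (a.val + 1) ∨ b.val + 1 = 2 * (a.val + 1) + 1)

/-- The leaf-extension of `H` by leaves `L` attached via `f`. -/
def leafExt {W : Type} (H : SimpleGraph W) (L : Type) (f : L → W) :
    SimpleGraph (W ⊕ L) :=
  SimpleGraph.fromRel (fun a b =>
    match a, b with
    | Sum.inl a, Sum.inl b => H.Adj a b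
    | Sum.inl a, Sum.inr x => f x = a
    | _, _ => False)

/-- `G` has treewidth at most `k` (via tree decompositions). -/
def TreewidthLE {V : Type} (G : SimpleGraph V) (k : ℕ) : Prop :=
  ∃ (ι : Type) (T : SimpleGraph ι) (bag : ι → Set V),
    T.IsTree ∧
    (∀ v, ∃ i, v ∈ bag i) ∧
    (∀ u v, G.Adj u v → ∃ i, u ∈ bag i ∧ v ∈ bag i) ∧
    (∀ v, (T.induce {i | v ∈ bag i}).Connected) ∧
    (∀ i, (bag i).ncard ≤ k + 1)

/-- `G` has pathwidth at most `k` (via path decompositions). -/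
def PathwidthLE {V : Type} (G : SimpleGraph V) (k : ℕ) : Prop :=
  ∃ (n : ℕ) (bag : Fin n → Set V),
    (∀ v, ∃ i, v ∈ bag i) ∧
    (∀ u v, G.Adj u v → ∃ i, u ∈ bag i ∧ v ∈ bag i) ∧
    (∀ (v : V) (i j k' : Fin n), i ≤ j → j ≤ k' → v ∈ bag i → v ∈ bag k' → v ∈ bag j) ∧
    (∀ i, (bag i).ncard ≤ k + 1)

/-- An induced `(s,t)`-model in `G`. -/
def IsInducedModel {V : Type} (G : SimpleGraph V) {s t : ℕ}
    (A : Fin s → Set V) (B : Fin t → Set V) : Prop :=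
  (∀ i, (G.induce (A i)).Connected) ∧
  (∀ j, (G.induce (B j)).Connected) ∧
  (∀ i j : Fin s, i ≠ j → Anticomplete G (A i) (A j)) ∧
  (∀ i j : Fin t, i ≠ j → Anticomplete G (B i) (B j)) ∧
  (∀ (i : Fin s) (j : Fin t), Disjoint (A i) (B j) ∧ ¬ Anticomplete G (A i) (B j))

/-- The `A`-contraction of a model: each `A i` is contracted to the vertex `Sum.inl i`. -/
def AContraction {V : Type} (G : SimpleGraph V) {s t : ℕ}
    (A : Fin s → Set V) (B : Fin t → Set V) :
    SimpleGraph (Fin s ⊕ (⋃ j, B j : Set V)) :=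
  SimpleGraph.fromRel (fun x y =>
    match x, y with
    | Sum.inl i, Sum.inl i' => i ≠ i' ∧ ∃ a ∈ A i, ∃ a' ∈ A i', G.Adj a a'
    | Sum.inl i, Sum.inr b => ∃ a ∈ A i, G.Adj a ↑b
    | Sum.inr b, Sum.inr b' => G.Adj ↑b ↑b'
    | _, _ => False)

/-- A linear induced model is `d`-`A`-ample if its `A`-contraction is `d`-ample. -/
def ModelAAmple {V : Type} (G : SimpleGraph V) {s t : ℕ}
    (A : Fin s → Set V) (B : Fin t → Set V) (d : ℕ) : Prop :=
  DAmple (AContraction G A B) Set.univ (Set.range Sum.inl) d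

/-- A linear induced model is `d`-ample if it is `d`-`A`-ample and `d`-`B`-ample. -/
def ModelAmple {V : Type} (G : SimpleGraph V) {s t : ℕ}
    (A : Fin s → Set V) (B : Fin t → Set V) (d : ℕ) : Prop :=
  ModelAAmple G A B d ∧ ModelAAmple G B A d

/-- The zigzag sequences. -/
def Zseq : ℕ → List ℤ
  | 0 => []
  | 1 => [1]
  | 2 => [1, 2]
  | 3 => [1, 2, 3]
  | n + 4 =>
      (Zseq (n + 3)).dropLast ++ (((Zseq (n + 2)).map (· + 1)).reverse).dropLast
        ++ (Zseq (n + 3)).map (· + 1)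

/-- Collapse each maximal run of consecutive equal entries to a single entry. -/
def collapse (l : List ℤ) : List ℤ := l.destutter (· ≠ ·)

/-- `B` is an alignment in the sequence `A`. -/
def IsAlignment (A : List ℤ) (B : Finset ℤ) : Prop :=
  (∀ b ∈ B, b ∈ A) ∧
  ∃ i j : ℕ, i ≤ j ∧ j < A.length ∧
    ∀ b ∈ B,
      (collapse (((A.take (j + 1)).drop i).filter (fun a => decide (a ∈ B)))).count b = 1

theorem exists_ramsey_pairs (a b : ℕ) : ∃ N : ℕ, ∀ {α : Type} (f : α → ℕ)
    (T : α → α → Prop) (S : Finset α), Set.InjOn f S → N ≤ S.card →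
    (∃ A ⊆ S, A.card = a ∧ ∀ x ∈ A, ∀ y ∈ A, f x < f y → T x y) ∨
    (∃ B ⊆ S, B.card = b ∧ ∀ x ∈ B, ∀ y ∈ B, f x < f y → ¬ T x y) := by
  classical
  induction a generalizing b with
  | zero => exact ⟨0, fun f T S _ _ => Or.inl ⟨∅, by simp⟩⟩
  | succ a iha =>
    induction b with
    | zero => exact ⟨0, fun f T S _ _ => Or.inr ⟨∅, by simp⟩⟩
    | succ b ihb =>
      obtain ⟨N₁, h₁⟩ := iha (b + 1)
      obtain ⟨N₂, h₂⟩ := ihb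
      refine ⟨N₁ + N₂ + 1, fun {α} f T S hf hS => ?_⟩
      have hne : S.Nonempty := Finset.card_pos.mp (by omega)
      obtain ⟨z, hz, hmax⟩ := Finset.exists_max_image S f hne
      have hc := Finset.card_filter_add_card_filter_not (s := S.erase z) (fun x => T x z)
      rw [Finset.card_erase_of_mem hz] at hc
      have hsub : ∀ (p : α → Prop) [DecidablePred p], (S.erase z).filter p ⊆ S := fun p _ =>
        (Finset.filter_subset _ _).trans (Finset.erase_subset _ _)
      rcases le_or_gt N₁ ((S.erase z).filter (fun x => T x z)).card with h | h
      · rcases h₁ f T _ (hf.mono (by exact_mod_cast hsub _)) h with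
          ⟨A, hA, hAc, hAT⟩ | ⟨B, hB, hBc, hBT⟩
        · refine Or.inl ⟨insert z A, Finset.insert_subset hz (hA.trans (hsub _)), ?_, ?_⟩
          · rw [Finset.card_insert_of_notMem, hAc]
            intro hzA; simpa using hA hzA
          · intro x hx y hy hxy
            have hxS : x ∈ S := Finset.insert_subset hz (hA.trans (hsub _)) hx
            have hyS : y ∈ S := Finset.insert_subset hz (hA.trans (hsub _)) hy
            rcases Finset.mem_insert.mp hx with rfl | hx₁
            · exact absurd (hmax y hyS) (by omega)
            rcases Finset.mem_insert.mp hy with rfl | hy₁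
            · exact (Finset.mem_filter.mp (hA hx₁)).2
            · exact hAT x hx₁ y hy₁ hxy
        · exact Or.inr ⟨B, hB.trans (hsub _), hBc, hBT⟩
      · rcases h₂ f T _ (hf.mono (by exact_mod_cast hsub (fun x => ¬ T x z))) (by omega) with
          ⟨A, hA, hAc, hAT⟩ | ⟨B, hB, hBc, hBT⟩
        · exact Or.inl ⟨A, hA.trans (hsub _), hAc, hAT⟩
        · refine Or.inr ⟨insert z B, Finset.insert_subset hz (hB.trans (hsub _)), ?_, ?_⟩
          · rw [Finset.card_insert_of_notMem, hBc]
            intro hzB; simpa using hB hzB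
          · intro x hx y hy hxy
            have hyS : y ∈ S := Finset.insert_subset hz (hB.trans (hsub _)) hy
            rcases Finset.mem_insert.mp hx with rfl | hx₁
            · exact absurd (hmax y hyS) (by omega)
            rcases Finset.mem_insert.mp hy with rfl | hy₁
            · exact (Finset.mem_filter.mp (hB hx₁)).2
            · exact hBT x hx₁ y hy₁ hxy

theorem exists_ramsey_triples (a b : ℕ) : ∃ N : ℕ, ∀ {α : Type} (f : α → ℕ)
    (T : α → α → α → Prop) (S : Finset α), Set.InjOn f S → N ≤ S.card →
    (∃ A ⊆ S, A.card = a ∧ ∀ x ∈ A, ∀ y ∈ A, ∀ z ∈ A, f x < f y → f y < f z → T x y z) ∨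
    (∃ B ⊆ S, B.card = b ∧ ∀ x ∈ B, ∀ y ∈ B, ∀ z ∈ B, f x < f y → f y < f z → ¬ T x y z) := by
  classical
  induction a generalizing b with
  | zero => exact ⟨0, fun f T S _ _ => Or.inl ⟨∅, by simp⟩⟩
  | succ a iha =>
    induction b with
    | zero => exact ⟨0, fun f T S _ _ => Or.inr ⟨∅, by simp⟩⟩
    | succ b ihb =>
      obtain ⟨N₁, h₁⟩ := iha (b + 1)
      obtain ⟨N₂, h₂⟩ := ihb
      obtain ⟨N, hN⟩ := exists_ramsey_pairs N₁ N₂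
      refine ⟨N + 1, fun {α} f T S hf hS => ?_⟩
      have hne : S.Nonempty := Finset.card_pos.mp (by omega)
      obtain ⟨z, hz, hmax⟩ := Finset.exists_max_image S f hne
      have hc := Finset.card_erase_of_mem hz
      have hes : S.erase z ⊆ S := Finset.erase_subset _ _
      have key : ∀ (A C : Finset α) (n : ℕ) (T' : α → α → α → Prop), C ⊆ S.erase z → A ⊆ C →
          A.card = n → (∀ x ∈ C, ∀ y ∈ C, f x < f y → T' x y z) →
          (∀ x ∈ A, ∀ y ∈ A, ∀ w ∈ A, f x < f y → f y < f w → T' x y w) →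
          ∃ A' ⊆ S, A'.card = n + 1 ∧
            ∀ x ∈ A', ∀ y ∈ A', ∀ w ∈ A', f x < f y → f y < f w → T' x y w := by
        intro A C n T' hC hA hAc hCT hAT
        have hsub : insert z A ⊆ S := Finset.insert_subset hz (hA.trans (hC.trans hes))
        refine ⟨insert z A, hsub, ?_, ?_⟩
        · rw [Finset.card_insert_of_notMem, hAc]
          intro hzA; simpa using hC (hA hzA)
        · intro x hx y hy w hw hxy hyw
          have hwS := hmax w (hsub hw)
          rcases Finset.mem_insert.mp hx with rfl | hx₁
          · omega
          rcases Finset.mem_insert.mp hy with rfl | hy₁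
          · omega
          rcases Finset.mem_insert.mp hw with rfl | hw₁
          · exact hCT x (hA hx₁) y (hA hy₁) hxy
          · exact hAT x hx₁ y hy₁ w hw₁ hxy hyw
      rcases hN f (fun x y => T x y z) (S.erase z) (hf.mono (by exact_mod_cast hes)) (by omega) with
        ⟨C, hC, hCc, hCT⟩ | ⟨C, hC, hCc, hCT⟩
      · rcases h₁ f T C (hf.mono (by exact_mod_cast hC.trans hes)) hCc.ge with
          ⟨A, hA, hAc, hAT⟩ | ⟨B, hB, hBc, hBT⟩
        · exact Or.inl (key A C a T hC hA hAc hCT hAT)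
        · exact Or.inr ⟨B, hB.trans (hC.trans hes), hBc, hBT⟩
      · rcases h₂ f T C (hf.mono (by exact_mod_cast hC.trans hes)) hCc.ge with
          ⟨A, hA, hAc, hAT⟩ | ⟨B, hB, hBc, hBT⟩
        · exact Or.inl ⟨A, hA.trans (hC.trans hes), hAc, hAT⟩
        · exact Or.inr (key B C b (fun x y w => ¬ T x y w) hC hB hBc hCT hBT)

/-- A set mapping that assigns fewer than `m` elements to every pair has large free sets. -/
theorem exists_free_set (k m : ℕ) : ∃ N : ℕ, ∀ {α : Type} (f : α → ℕ)
    (U : α → α → Finset α) (S : Finset α), Set.InjOn f S → N ≤ S.card →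
    (∀ x ∈ S, ∀ y ∈ S, f x < f y → (U x y).card < m) →
    ∃ B ⊆ S, B.card = k ∧ ∀ x ∈ B, ∀ y ∈ B, ∀ z ∈ B, f x < f y → z ≠ x → z ≠ y →
      z ∉ U x y := by
  classical
  obtain ⟨N₁, h₁⟩ := exists_ramsey_triples (m + 2) k
  obtain ⟨N₂, h₂⟩ := exists_ramsey_triples (m + 2) N₁
  obtain ⟨N₃, h₃⟩ := exists_ramsey_triples (m + 2) N₂
  refine ⟨N₃, fun {α} f U S hf hS hU => ?_⟩
  have two : ∀ A ⊆ S, A.card = m + 2 → ∃ x ∈ A, ∃ z ∈ A, f x < f z ∧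
      ((A.erase x).erase z).card = m ∧
        ∀ y ∈ (A.erase x).erase z, y ∈ A ∧ f x < f y ∧ f y < f z := by
    intro A hA hAc
    obtain ⟨x, hx, hxm⟩ := Finset.exists_min_image A f (Finset.card_pos.mp (by omega))
    obtain ⟨z, hz, hzm⟩ := Finset.exists_max_image (A.erase x) f
      (Finset.card_pos.mp (by rw [Finset.card_erase_of_mem hx]; omega))
    have hz' := Finset.mem_erase.mp hz
    have hlt : ∀ u ∈ A, ∀ v ∈ A, u ≠ v → f u ≤ f v → f u < f v := fun u hu v hv huv hle =>
      lt_of_le_of_ne hle fun h => huv (hf (hA hu) (hA hv) h)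
    refine ⟨x, hx, z, hz'.2, hlt x hx z hz'.2 (Ne.symm hz'.1) (hxm z hz'.2), ?_, fun y hy => ?_⟩
    · rw [Finset.card_erase_of_mem hz, Finset.card_erase_of_mem hx]; omega
    · simp only [Finset.mem_erase] at hy
      exact ⟨hy.2.2, hlt x hx y hy.2.2 (Ne.symm hy.2.1) (hxm y hy.2.2),
        hlt y hy.2.2 z hz'.2 hy.1 (hzm y (Finset.mem_erase.mpr hy.2))⟩
  have full : ∀ x ∈ S, ∀ y ∈ S, f x < f y → ∀ C : Finset α, C.card = m → ¬ C ⊆ U x y :=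
    fun x hx y hy hxy C hC hCU => by
      have := Finset.card_le_card hCU
      have := hU x hx y hy hxy
      omega
  rcases h₃ f (fun x y z => y ∈ U x z) S hf hS with ⟨A, hA, hAc, hAT⟩ | ⟨S₁, hS₁, hc₁, hT₁⟩
  · obtain ⟨x, hx, z, hz, hxz, hc, hm⟩ := two A hA hAc
    exact absurd (fun y hy => hAT x hx y (hm y hy).1 z hz (hm y hy).2.1 (hm y hy).2.2)
      (full x (hA hx) z (hA hz) hxz _ hc)
  rcases h₂ f (fun x y z => z ∈ U x y) S₁ (hf.mono (by exact_mod_cast hS₁)) hc₁.ge with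
    ⟨A, hA, hAc, hAT⟩ | ⟨S₂, hS₂, hc₂, hT₂⟩
  · obtain ⟨x, hx, hxm⟩ := Finset.exists_min_image A f (Finset.card_pos.mp (by omega))
    obtain ⟨y, hy, hym⟩ := Finset.exists_min_image (A.erase x) f
      (Finset.card_pos.mp (by rw [Finset.card_erase_of_mem hx]; omega))
    have hy' := Finset.mem_erase.mp hy
    have hlt : ∀ u ∈ A, ∀ v ∈ A, u ≠ v → f u ≤ f v → f u < f v := fun u hu v hv huv hle =>
      lt_of_le_of_ne hle fun h => huv (hf (hS₁ (hA hu)) (hS₁ (hA hv)) h)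
    have hxy := hlt x hx y hy'.2 hy'.1.symm (hxm y hy'.2)
    refine absurd (fun z hz => ?_) (full x (hS₁ (hA hx)) y (hS₁ (hA hy'.2)) hxy
      ((A.erase x).erase y) ?_)
    · simp only [Finset.mem_erase] at hz
      exact hAT x hx y hy'.2 z hz.2.2 hxy
        (hlt y hy'.2 z hz.2.2 hz.1.symm (hym z (Finset.mem_erase.mpr hz.2)))
    · rw [Finset.card_erase_of_mem hy, Finset.card_erase_of_mem hx]; omega
  have hS₂S : S₂ ⊆ S := hS₂.trans hS₁
  rcases h₁ f (fun x y z => x ∈ U y z) S₂ (hf.mono (by exact_mod_cast hS₂S)) hc₂.ge with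
    ⟨A, hA, hAc, hAT⟩ | ⟨B, hB, hBc, hBT⟩
  · obtain ⟨z, hz, hzm⟩ := Finset.exists_max_image A f (Finset.card_pos.mp (by omega))
    obtain ⟨y, hy, hym⟩ := Finset.exists_max_image (A.erase z) f
      (Finset.card_pos.mp (by rw [Finset.card_erase_of_mem hz]; omega))
    have hy' := Finset.mem_erase.mp hy
    have hlt : ∀ u ∈ A, ∀ v ∈ A, u ≠ v → f u ≤ f v → f u < f v := fun u hu v hv huv hle =>
      lt_of_le_of_ne hle fun h => huv (hf (hS₂S (hA hu)) (hS₂S (hA hv)) h)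
    have hyz := hlt y hy'.2 z hz hy'.1 (hzm y hy'.2)
    refine absurd (fun x hx => ?_) (full y (hS₂S (hA hy'.2)) z (hS₂S (hA hz)) hyz
      ((A.erase z).erase y) ?_)
    · simp only [Finset.mem_erase] at hx
      exact hAT x hx.2.2 y hy'.2 z hz
        (hlt x hx.2.2 y hy'.2 hx.1 (hym x (Finset.mem_erase.mpr hx.2))) hyz
    · rw [Finset.card_erase_of_mem hy, Finset.card_erase_of_mem hz]; omega
  refine ⟨B, hB.trans hS₂S, hBc, fun x hx y hy z hz hxy hzx hzy hzU => ?_⟩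
  have hfzx : f z ≠ f x := fun h => hzx (hf (hS₂S (hB hz)) (hS₂S (hB hx)) h)
  have hfzy : f z ≠ f y := fun h => hzy (hf (hS₂S (hB hz)) (hS₂S (hB hy)) h)
  rcases lt_or_gt_of_ne hfzx with h | h
  · exact hBT z hz x hx y hy h hxy hzU
  rcases lt_or_gt_of_ne hfzy with h' | h'
  · exact hT₁ x (hS₂ (hB hx)) z (hS₂ (hB hz)) y (hS₂ (hB hy)) h h' hzU
  · exact hT₂ x (hB hx) y (hB hy) z (hB hz) hxy h' hzU

/-- Every `P i` with `i ∈ I` is good and touched by every element of `A`. -/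
def Dominated {V ι : Type} (T : V → Set V → Prop) (Good : Set V → Prop)
    (A : Finset V) (I : Finset ι) (P : ι → Set V) : Prop :=
  ∀ i ∈ I, Good (P i) ∧ ∀ a ∈ A, T a (P i)

/-- The mixed condition for an abstract family `P` of paths with route relation `R`. -/
def FamilyMixed {V ι : Type} (T : V → Set V → Prop) (R : V → V → Set V → Prop) (f : V → ℕ)
    (A : Finset V) (I : Finset ι) (P : ι → Set V) (qm q qp : ℕ) : Prop :=
  ∀ x ∈ A, ∀ y ∈ A, f x < f y → ∀ i ∈ I, ∀ X ⊆ P i, R x y X →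
    ∀ Qm ⊆ A, ∀ Q ⊆ A, ∀ Qp ⊆ A, Qm.card = qm → Q.card = q → Qp.card = qp →
      (∀ z ∈ Qm, f z < f x) → (∀ z ∈ Q, f x < f z ∧ f z < f y) → (∀ z ∈ Qp, f y < f z) →
      ∃ z, (z ∈ Qm ∨ z ∈ Q ∨ z ∈ Qp) ∧ T z X

/-- The interrupted condition for an abstract family of paths. -/
def FamilyInterrupted {V ι : Type} (T : V → Set V → Prop) (R : V → V → Set V → Prop)
    (A : Finset V) (I : Finset ι) (P : ι → Set V) : Prop :=
  ∃ f : V → ℕ, Set.InjOn f A ∧ ∀ x ∈ A, ∀ y ∈ A, ∀ z ∈ A, f x < f y → f y < f z →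
    ∀ i ∈ I, ∀ X ⊆ P i, R x y X → T z X

/-- The zigzagged condition for an abstract family of paths. -/
def FamilyZigzagged {V ι : Type} (T : V → Set V → Prop) (R : V → V → Set V → Prop) (q : ℕ)
    (A : Finset V) (I : Finset ι) (P : ι → Set V) : Prop :=
  ∃ f : V → ℕ, Set.InjOn f A ∧ ∀ x ∈ A, ∀ y ∈ A, f x < f y →
    ∀ i ∈ I, ∀ X ⊆ P i, R x y X →
      {z | z ∈ A ∧ f x < f z ∧ f z < f y ∧ ¬ T z X}.ncard < q

/-- There are `k` elements of `A`, any two of which are joined by a route that is not touched by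
the others, the routes lying in different members of the family. -/
def FamilyClique {V ι : Type} (T : V → Set V → Prop) (R : V → V → Set V → Prop) (k : ℕ)
    (A : Finset V) (I : Finset ι) (P : ι → Set V) : Prop :=
  ∃ B ⊆ A, B.card = k ∧ ∃ f : V → ℕ, Set.InjOn f B ∧
    ∃ (φ : V → V → ι) (X : V → V → Set V),
      (∀ x ∈ B, ∀ y ∈ B, f x < f y → φ x y ∈ I ∧ X x y ⊆ P (φ x y) ∧ R x y (X x y) ∧
        ∀ z ∈ B, z ≠ x → z ≠ y → ¬ T z (X x y)) ∧
      ∀ x ∈ B, ∀ y ∈ B, ∀ u ∈ B, ∀ v ∈ B, f x < f y → f u < f v →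
        φ x y = φ u v → x = u ∧ y = v

/-- A dominated `s`-by-`l` subfamily satisfying `C`. -/
def HasSubfamily {V ι : Type} (T : V → Set V → Prop) (Good : Set V → Prop)
    (C : Finset V → Finset ι → (ι → Set V) → Prop) (s l : ℕ)
    (A : Finset V) (I : Finset ι) (P : ι → Set V) : Prop :=
  ∃ B ⊆ A, ∃ J ⊆ I, ∃ Q : ι → Set V, (∀ i ∈ J, Q i ⊆ P i) ∧ Dominated T Good B J Q ∧
    B.card = s ∧ J.card = l ∧ C B J Q

/-- The trichotomy for an abstract family of paths. -/
def FamilyOutcome {V ι : Type} (T : V → Set V → Prop) (R : V → V → Set V → Prop)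
    (Good : Set V → Prop) (k s l s' l' q : ℕ)
    (A : Finset V) (I : Finset ι) (P : ι → Set V) : Prop :=
  FamilyClique T R k A I P ∨ HasSubfamily T Good (FamilyInterrupted T R) s l A I P ∨
    HasSubfamily T Good (FamilyZigzagged T R q) s' l' A I P

theorem Dominated.mono {V ι : Type} {T : V → Set V → Prop} {Good : Set V → Prop}
    {A A' : Finset V} {I I' : Finset ι} {P : ι → Set V} (h : Dominated T Good A I P)
    (hA : A' ⊆ A) (hI : I' ⊆ I) : Dominated T Good A' I' P :=
  fun i hi => ⟨(h i (hI hi)).1, fun a ha => (h i (hI hi)).2 a (hA ha)⟩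

theorem HasSubfamily.mono {V ι : Type} {T : V → Set V → Prop} {Good : Set V → Prop}
    {C : Finset V → Finset ι → (ι → Set V) → Prop} {s l : ℕ}
    {A A' : Finset V} {I I' : Finset ι} {P P' : ι → Set V}
    (h : HasSubfamily T Good C s l A' I' P') (hA : A' ⊆ A) (hI : I' ⊆ I)
    (hP : ∀ i ∈ I', P' i ⊆ P i) : HasSubfamily T Good C s l A I P := by
  obtain ⟨A'', hA'', I'', hI'', P'', hP'', h⟩ := h
  exact ⟨A'', hA''.trans hA, I'', hI''.trans hI, P'',
    fun i hi => (hP'' i hi).trans (hP i (hI'' hi)), h⟩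

theorem FamilyOutcome.mono {V ι : Type} {T : V → Set V → Prop} {R : V → V → Set V → Prop}
    {Good : Set V → Prop} {k s l s' l' q : ℕ}
    {A A' : Finset V} {I I' : Finset ι} {P P' : ι → Set V}
    (h : FamilyOutcome T R Good k s l s' l' q A' I' P') (hA : A' ⊆ A) (hI : I' ⊆ I)
    (hP : ∀ i ∈ I', P' i ⊆ P i) : FamilyOutcome T R Good k s l s' l' q A I P := by
  rcases h with ⟨B, hB, hBc, f, hf, φ, X, h₁, h₂⟩ | h | h
  · refine Or.inl ⟨B, hB.trans hA, hBc, f, hf, φ, X, fun x hx y hy hxy => ?_, h₂⟩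
    obtain ⟨a, b, c⟩ := h₁ x hx y hy hxy
    exact ⟨hI a, b.trans (hP _ a), c⟩
  · exact Or.inr (Or.inl (h.mono hA hI hP))
  · exact Or.inr (Or.inr (h.mono hA hI hP))

theorem FamilyMixed.reverse {V ι : Type} {T : V → Set V → Prop} {R : V → V → Set V → Prop}
    {f : V → ℕ} {A : Finset V} {I : Finset ι} {P : ι → Set V} {qm q qp : ℕ}
    (hR : ∀ x y X, R x y X → R y x X) (h : FamilyMixed T R f A I P qm q qp) :
    FamilyMixed T R (fun v => A.sup f - f v) A I P qp q qm := by
  intro x hx y hy hxy i hi X hX hRX Qm hQm Q hQ Qp hQp hcm hc hcp hm hq hp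
  have hle : ∀ v ∈ A, f v ≤ A.sup f := fun v hv => Finset.le_sup hv
  have hxl := hle x hx
  have hyl := hle y hy
  simp only at hxy
  obtain ⟨z, hz, hT⟩ := h y hy x hx (by omega) i hi X hX (hR _ _ _ hRX) Qp hQp Q hQ Qm hQm
    hcp hc hcm
    (fun z hz => by have := hp z hz; have := hle z (hQp hz); simp only at *; omega)
    (fun z hz => by have := hq z hz; have := hle z (hQ hz); simp only at *; omega)
    (fun z hz => by have := hm z hz; have := hle z (hQm hz); simp only at *; omega)
  exact ⟨z, by tauto, hT⟩

theorem FamilyMixed.hasSubfamily_zigzagged {V ι : Type} {T : V → Set V → Prop}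
    {R : V → V → Set V → Prop} {Good : Set V → Prop} {f : V → ℕ} {A : Finset V} {I : Finset ι}
    {P : ι → Set V} {q s l : ℕ} (h : FamilyMixed T R f A I P 0 q 0) (hf : Set.InjOn f A)
    (hD : Dominated T Good A I P) (hs : s ≤ A.card) (hl : l ≤ I.card) :
    HasSubfamily T Good (FamilyZigzagged T R q) s l A I P := by
  classical
  obtain ⟨A', hA', hA'c⟩ := Finset.exists_subset_card_eq hs
  obtain ⟨I', hI', hI'c⟩ := Finset.exists_subset_card_eq hl
  refine ⟨A', hA', I', hI', P, fun _ _ => subset_rfl, hD.mono hA' hI', hA'c, hI'c, f,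
    hf.mono (by exact_mod_cast hA'), fun x hx y hy hxy i hi X hX hR => ?_⟩
  by_contra! hq
  have heq : {z | z ∈ A' ∧ f x < f z ∧ f z < f y ∧ ¬ T z X} =
      ((A'.filter fun z => f x < f z ∧ f z < f y ∧ ¬ T z X : Finset V) : Set V) := by
    ext z; simp
  rw [heq, Set.ncard_coe_finset] at hq
  obtain ⟨Q, hQ, hQc⟩ := Finset.exists_subset_card_eq hq
  have hQm : ∀ z ∈ Q, z ∈ A' ∧ f x < f z ∧ f z < f y ∧ ¬ T z X := fun z hz =>
    Finset.mem_filter.mp (hQ hz)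
  obtain ⟨z, hz, hT⟩ := h x (hA' hx) y (hA' hy) hxy i (hI' hi) X hX hR ∅ (by simp) Q
    (fun z hz => hA' (hQm z hz).1) ∅ (by simp) rfl hQc rfl (by simp)
    (fun z hz => ⟨(hQm z hz).2.1, (hQm z hz).2.2.1⟩) (by simp)
  simp only [Finset.notMem_empty, or_false, false_or] at hz
  exact (hQm z hz).2.2.2 hT

/-- The trichotomy, from the case where `qp` is one smaller. -/
theorem exists_familyOutcome_succ (k s l s' l' F₀ Γ₀ : ℕ) (hΓ₀ : 0 < Γ₀) :
    ∃ F Γ : ℕ, ∀ (q qm qp : ℕ)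
    {V ι : Type} (T : V → Set V → Prop) (R : V → V → Set V → Prop) (Good : Set V → Prop)
    (_ : ∀ x y X, R x y X → Good X) (f : V → ℕ) (A : Finset V) (I : Finset ι) (P : ι → Set V),
    (∀ (A' : Finset V) (I' : Finset ι) (P' : ι → Set V), A' ⊆ A → F₀ ≤ A'.card → Γ₀ ≤ I'.card →
      Dominated T Good A' I' P' → FamilyMixed T R f A' I' P' qm q qp →
      FamilyOutcome T R Good k s l s' l' q A' I' P') →
    Set.InjOn f A → F ≤ A.card → Γ ≤ I.card → Dominated T Good A I P →
    FamilyMixed T R f A I P qm q (qp + 1) → (∀ z ∈ A, ∀ X Y, X ⊆ Y → T z X → T z Y) →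
    FamilyOutcome T R Good k s l s' l' q A I P := by
  classical
  obtain ⟨N, hN⟩ := exists_free_set k F₀
  obtain ⟨F, hF⟩ := exists_ramsey_triples s (N + 1)
  refine ⟨F, 2 ^ (F * (F * F)) * (l + (2 ^ N * Γ₀ + N * N)) + 1, ?_⟩
  intro q qm qp V ι T R Good hRG f A I P ih hf hA hI hD hM hT
  obtain ⟨A₀, hA₀, hA₀c⟩ := Finset.exists_subset_card_eq hA
  -- the triples `x < y < z` for which some route from `x` to `y` in `P i` avoids `z`
  let avoid : ι → V → V → V → Prop := fun i x y z => ∃ X ⊆ P i, R x y X ∧ ¬ T z X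
  let pat : ι → Finset (V × V × V) := fun i =>
    (A₀ ×ˢ A₀ ×ˢ A₀).filter fun p => avoid i p.1 p.2.1 p.2.2
  have hpat : ∀ i ∈ I, pat i ∈ (A₀ ×ˢ A₀ ×ˢ A₀).powerset := fun i _ =>
    Finset.mem_powerset.mpr (Finset.filter_subset _ _)
  obtain ⟨D, -, hDc⟩ := Finset.exists_le_card_fiber_of_mul_le_card_of_maps_to hpat ⟨∅, by simp⟩
    (n := l + (2 ^ N * Γ₀ + N * N)) (by
      rw [Finset.card_powerset, Finset.card_product, Finset.card_product, hA₀c]; omega)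
  set J := I.filter fun i => pat i = D with hJ
  have hJI : J ⊆ I := Finset.filter_subset _ _
  have hJD : ∀ i ∈ J, ∀ x ∈ A₀, ∀ y ∈ A₀, ∀ z ∈ A₀, ((x, y, z) ∈ D ↔ avoid i x y z) := by
    intro i hi x hx y hy z hz
    rw [← (Finset.mem_filter.mp hi).2]
    simp [pat, hx, hy, hz]
  rcases hF f (fun x y z => (x, y, z) ∉ D) A₀ (hf.mono (by exact_mod_cast hA₀)) hA₀c.ge with
    ⟨A₁, hA₁, hA₁c, hA₁T⟩ | ⟨A₁, hA₁, hA₁c, hA₁T⟩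
  · obtain ⟨I', hI', hI'c⟩ := Finset.exists_subset_card_eq (show l ≤ J.card by omega)
    refine Or.inr (Or.inl ⟨A₁, hA₁.trans hA₀, I', hI'.trans hJI, P, fun _ _ => subset_rfl,
      hD.mono (hA₁.trans hA₀) (hI'.trans hJI), hA₁c, hI'c, f,
      hf.mono (by exact_mod_cast hA₁.trans hA₀), ?_⟩)
    intro x hx y hy z hz hxy hyz i hi X hX hR
    by_contra hTz
    exact hA₁T x hx y hy z hz hxy hyz
      ((hJD i (hI' hi) x (hA₁ hx) y (hA₁ hy) z (hA₁ hz)).mpr ⟨X, hX, hR, hTz⟩)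
  have hA₁A : A₁ ⊆ A := hA₁.trans hA₀
  obtain ⟨z, hz, hzm⟩ := Finset.exists_max_image A₁ f (Finset.card_pos.mp (by omega))
  set E := A₁.erase z with hE
  have hEA₁ : E ⊆ A₁ := Finset.erase_subset _ _
  have hEc : E.card = N := by rw [hE, Finset.card_erase_of_mem hz]; omega
  have hEz : ∀ x ∈ E, f x < f z := fun x hx => by
    obtain ⟨hxz, hxA⟩ := Finset.mem_erase.mp hx
    exact lt_of_le_of_ne (hzm x hxA) fun h => hxz (hf (hA₁A hxA) (hA₁A hz) h)
  have hav : ∀ i ∈ J, ∀ x ∈ E, ∀ y ∈ E, f x < f y → avoid i x y z := fun i hi x hx y hy hxy =>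
    (hJD i hi x (hA₁ (hEA₁ hx)) y (hA₁ (hEA₁ hy)) z (hA₁ hz)).mp
      (not_not.mp (hA₁T x (hEA₁ hx) y (hEA₁ hy) z hz hxy (hEz y hy)))
  let rich : ι → Prop := fun i => ∃ X ⊆ P i, ¬ T z X ∧ Good X ∧ F₀ ≤ (E.filter fun a => T a X).card
  have hsplit := Finset.card_filter_add_card_filter_not (s := J) rich
  rcases le_or_gt (2 ^ N * Γ₀) (J.filter rich).card with hrich | hrich
  · have : ∀ i, ∃ X : Set V, rich i → X ⊆ P i ∧ ¬ T z X ∧ Good X ∧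
        F₀ ≤ (E.filter fun a => T a X).card := fun i => by
      by_cases h : rich i
      · obtain ⟨X, hX⟩ := h
        exact ⟨X, fun _ => hX⟩
      · exact ⟨∅, fun h' => absurd h' h⟩
    choose P' hP' using this
    obtain ⟨A', -, hA'c⟩ := Finset.exists_le_card_fiber_of_mul_le_card_of_maps_to
      (s := J.filter rich) (t := E.powerset) (f := fun i => E.filter fun a => T a (P' i)) (n := Γ₀)
      (fun i _ => Finset.mem_powerset.mpr (Finset.filter_subset _ _)) ⟨∅, by simp⟩
      (by rw [Finset.card_powerset, hEc]; exact hrich)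
    set I' := (J.filter rich).filter fun i => (E.filter fun a => T a (P' i)) = A' with hI'
    have hI'm : ∀ i ∈ I', i ∈ I ∧ rich i ∧ (E.filter fun a => T a (P' i)) = A' := fun i hi => by
      simp only [hI', Finset.mem_filter] at hi
      exact ⟨hJI hi.1.1, hi.1.2, hi.2⟩
    have hI'P : ∀ i ∈ I', P' i ⊆ P i := fun i hi => (hP' i (hI'm i hi).2.1).1
    obtain ⟨i₀, hi₀⟩ : I'.Nonempty := Finset.card_pos.mp (hΓ₀.trans_le hA'c)
    have hA'E : A' ⊆ E := by
      rw [← (hI'm i₀ hi₀).2.2]; exact Finset.filter_subset _ _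
    have hA'A : A' ⊆ A := hA'E.trans (hEA₁.trans hA₁A)
    refine (ih A' I' P' hA'A ?_ hA'c ?_ ?_).mono hA'A (fun i hi => (hI'm i hi).1) hI'P
    · rw [← (hI'm i₀ hi₀).2.2]
      exact (hP' i₀ (hI'm i₀ hi₀).2.1).2.2.2
    · intro i hi
      obtain ⟨hiI, hir, hiA⟩ := hI'm i hi
      refine ⟨(hP' i hir).2.2.1, fun a ha => ?_⟩
      rw [← hiA] at ha
      exact (Finset.mem_filter.mp ha).2
    · intro x hx y hy hxy i hi X hX hR Qm hQm Q hQ Qp hQp hcm hc hcp hm hq hp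
      obtain ⟨hiI, hir, hiA⟩ := hI'm i hi
      have hzQp : z ∉ Qp := fun h => lt_irrefl _ (hEz z (hA'E (hQp h)))
      obtain ⟨w, hw, hTw⟩ := hM x (hA'A hx) y (hA'A hy) hxy i hiI X (hX.trans (hI'P i hi)) hR
        Qm (hQm.trans hA'A) Q (hQ.trans hA'A) (insert z Qp)
        (Finset.insert_subset (hA₁A hz) (hQp.trans hA'A)) hcm hc
        (by rw [Finset.card_insert_of_notMem hzQp, hcp]) hm hq (fun w hw => by
          rcases Finset.mem_insert.mp hw with rfl | hw
          · exact hEz y (hA'E hy)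
          · exact hp w hw)
      have hwz : w ≠ z := fun h =>
        (hP' i hir).2.1 (hT z (hA₁A hz) X (P' i) hX (h ▸ hTw))
      refine ⟨w, ?_, hTw⟩
      simpa [hwz] using hw
  · -- most members of the family are poor, so their routes can be freed from each other
    set K := J.filter fun i => ¬ rich i with hK
    have hKJ : K ⊆ J := Finset.filter_subset _ _
    have hKc : (E ×ˢ E).card ≤ K.card := by
      rw [Finset.card_product, hEc]; omega
    obtain ⟨ψ, hψK, hψ⟩ : ∃ ψ : V × V → ι, (∀ p ∈ E ×ˢ E, ψ p ∈ K) ∧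
        Set.InjOn ψ (E ×ˢ E : Finset (V × V)) := by
      obtain ⟨i, -⟩ : I.Nonempty := Finset.card_pos.mp (by omega)
      have : Nonempty ι := ⟨i⟩
      obtain ⟨ψ, h₁, h₂⟩ := (E ×ˢ E).finite_toSet.exists_injOn_of_encard_le (t := (K : Set ι))
        (by rw [Set.encard_coe_eq_coe_finsetCard, Set.encard_coe_eq_coe_finsetCard]
            exact_mod_cast hKc)
      exact ⟨ψ, fun p hp => by simpa using h₁ (Finset.mem_coe.mpr hp), h₂⟩
    have : ∀ p : V × V, ∃ X : Set V, p ∈ E ×ˢ E → f p.1 < f p.2 →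
        X ⊆ P (ψ p) ∧ R p.1 p.2 X ∧ (E.filter fun a => T a X).card < F₀ := fun p => by
      by_cases h : p ∈ E ×ˢ E ∧ f p.1 < f p.2
      · have hpK := hψK p h.1
        have hp := Finset.mem_product.mp h.1
        obtain ⟨X, hX, hR, hTX⟩ := hav (ψ p) (hKJ hpK) p.1 hp.1 p.2 hp.2 h.2
        refine ⟨X, fun _ _ => ⟨hX, hR, ?_⟩⟩
        by_contra! hge
        exact (Finset.mem_filter.mp hpK).2 ⟨X, hX, hTX, hRG _ _ _ hR, hge⟩
      · exact ⟨∅, fun h₁ h₂ => absurd ⟨h₁, h₂⟩ h⟩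
    choose X hX using this
    have hEinj : Set.InjOn f E := hf.mono (by exact_mod_cast hEA₁.trans hA₁A)
    have hpair : ∀ {x y}, x ∈ E → y ∈ E → (x, y) ∈ E ×ˢ E := fun hx hy =>
      Finset.mem_product.mpr ⟨hx, hy⟩
    obtain ⟨B, hB, hBc, hBfree⟩ := hN f (fun x y => E.filter fun a => T a (X (x, y))) E hEinj hEc.ge
      (fun x hx y hy hxy => (hX (x, y) (hpair hx hy) hxy).2.2)
    refine Or.inl ⟨B, hB.trans (hEA₁.trans hA₁A), hBc, f, hEinj.mono (by exact_mod_cast hB),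
      fun x y => ψ (x, y), fun x y => X (x, y), ?_, ?_⟩
    · intro x hx y hy hxy
      have h := hX (x, y) (hpair (hB hx) (hB hy)) hxy
      refine ⟨hJI (hKJ (hψK _ (hpair (hB hx) (hB hy)))), h.1, h.2.1, fun w hw hwx hwy hTw => ?_⟩
      exact hBfree x hx y hy w hw hxy hwx hwy (Finset.mem_filter.mpr ⟨hB hw, hTw⟩)
    · intro x hx y hy x' hx' y' hy' _ _ h
      exact Prod.mk.inj (hψ (by exact_mod_cast hpair (hB hx) (hB hy))
        (by exact_mod_cast hpair (hB hx') (hB hy')) h)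

theorem exists_familyOutcome (k s l s' l' σ : ℕ) : ∃ F Γ : ℕ, ∀ (q qm qp : ℕ), qm + qp = σ →
    ∀ {V ι : Type} (T : V → Set V → Prop) (R : V → V → Set V → Prop) (Good : Set V → Prop)
    (_ : ∀ x y X, R x y X → Good X) (_ : ∀ x y X, R x y X → R y x X)
    (_ : ∀ z X Y, X ⊆ Y → T z X → T z Y)
    (f : V → ℕ) (A : Finset V) (I : Finset ι) (P : ι → Set V),
    Set.InjOn f A → F ≤ A.card → Γ ≤ I.card → Dominated T Good A I P →
    FamilyMixed T R f A I P qm q qp → FamilyOutcome T R Good k s l s' l' q A I P := by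
  induction σ with
  | zero =>
    refine ⟨s', l', fun q qm qp h V ι T R Good _ _ _ f A I P hf hA hI hD hM => ?_⟩
    obtain ⟨rfl, rfl⟩ : qm = 0 ∧ qp = 0 := by omega
    exact Or.inr (Or.inr (hM.hasSubfamily_zigzagged hf hD hA hI))
  | succ σ ih =>
    obtain ⟨F₀, Γ₀, h₀⟩ := ih
    obtain ⟨F, Γ, h⟩ := exists_familyOutcome_succ k s l s' l' F₀ (Γ₀ + 1) (by omega)
    refine ⟨F, Γ, fun q qm qp hq V ι T R Good hRG hRs hT f A I P hf hA hI hD hM => ?_⟩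
    have main : ∀ (f : V → ℕ) (qm qp : ℕ), qm + qp = σ → Set.InjOn f A →
        FamilyMixed T R f A I P qm q (qp + 1) → FamilyOutcome T R Good k s l s' l' q A I P := by
      intro f qm qp hq hf hM
      exact h q qm qp T R Good hRG f A I P (fun A' I' P' hA' hF hΓ hD' hM' =>
        h₀ q qm qp hq T R Good hRG hRs hT f A' I' P' (hf.mono (by exact_mod_cast hA')) hF
          (by omega) hD' hM') hf hA hI hD hM (fun z _ => hT z)
    rcases qp with _ | qp
    · obtain ⟨qm, rfl⟩ : ∃ n, qm = n + 1 := ⟨qm - 1, by omega⟩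
      refine main _ 0 qm (by omega) (fun x hx y hy hxy => hf hx hy ?_) (hM.reverse hRs)
      have hx' : f x ≤ A.sup f := Finset.le_sup hx
      have hy' : f y ≤ A.sup f := Finset.le_sup hy
      omega
    · exact main f qm qp (by omega) hf hM

theorem subset_of_induce_connected {V : Type} {G : SimpleGraph V} {X L : Set V}
    (hX : (G.induce X).Connected) (hL : ∀ u ∈ L, ∀ v ∈ X, G.Adj u v → v ∈ L)
    {u : V} (huX : u ∈ X) (huL : u ∈ L) : X ⊆ L := by
  intro v hv
  have h := (SimpleGraph.reachable_iff_reflTransGen _ _).mp (hX.preconnected ⟨u, huX⟩ ⟨v, hv⟩)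
  suffices ∀ w : X, Relation.ReflTransGen (G.induce X).Adj ⟨u, huX⟩ w → (w : V) ∈ L from
    this _ h
  intro w hw
  induction hw with
  | refl => exact huL
  | @tail b c _ hbc ih => exact hL b ih c c.2 hbc

theorem mem_compsOn_iff {V : Type} {G : SimpleGraph V} {U L : Set V} :
    L ∈ CompsOn G U ↔
      L ⊆ U ∧ (G.induce L).Connected ∧ ∀ u ∈ L, ∀ v ∈ U, G.Adj u v → v ∈ L := by
  constructor
  · rintro ⟨C, rfl⟩
    refine ⟨fun v ⟨w, _, hw⟩ => hw ▸ w.2, ?_, ?_⟩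
    · have hC : ((G.induce U).induce C.supp).Connected := C.connected_toSimpleGraph
      let φ : (G.induce U).induce C.supp →g G.induce (Subtype.val '' C.supp) :=
        { toFun := fun w => ⟨w.1.1, w.1, w.2, rfl⟩
          map_rel' := fun h => h }
      refine hC.map φ ?_
      rintro ⟨_, w, hw, rfl⟩
      exact ⟨⟨w, hw⟩, rfl⟩
    · rintro _ ⟨u, hu, rfl⟩ v hv huv
      refine ⟨⟨v, hv⟩, ?_, rfl⟩
      rw [SimpleGraph.ConnectedComponent.mem_supp_iff] at hu ⊢
      rw [← hu, SimpleGraph.ConnectedComponent.eq]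
      exact (SimpleGraph.Adj.reachable (show (G.induce U).Adj u ⟨v, hv⟩ from huv)).symm
  · rintro ⟨hLU, hL, hcl⟩
    obtain ⟨u, hu⟩ := hL.nonempty
    refine ⟨(G.induce U).connectedComponentMk ⟨u, hLU hu⟩, subset_antisymm ?_ ?_⟩
    · intro v hv
      refine ⟨⟨v, hLU hv⟩, ?_, rfl⟩
      rw [SimpleGraph.ConnectedComponent.mem_supp_iff, SimpleGraph.ConnectedComponent.eq]
      exact (hL.preconnected ⟨v, hv⟩ ⟨u, hu⟩).map (SimpleGraph.induceHomOfLE G hLU).toHom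
    · rintro _ ⟨v, hv, rfl⟩
      rw [SimpleGraph.ConnectedComponent.mem_supp_iff, SimpleGraph.ConnectedComponent.eq] at hv
      have h := (SimpleGraph.reachable_iff_reflTransGen _ _).mp hv.symm
      induction h with
      | refl => exact hu
      | @tail b c hab hbc ih =>
        exact hcl b (ih ((SimpleGraph.reachable_iff_reflTransGen _ _).mpr hab).symm) c c.2 hbc

theorem eq_of_mem_compsOn {V : Type} {G : SimpleGraph V} {U L L' : Set V}
    (hL : L ∈ CompsOn G U) (hL' : L' ∈ CompsOn G U) {v : V} (hv : v ∈ L) (hv' : v ∈ L') :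
    L = L' := by
  rw [mem_compsOn_iff] at hL hL'
  exact subset_antisymm
    (subset_of_induce_connected hL.2.1 (fun u hu w hw => hL'.2.2 u hu w (hL.1 hw)) hv hv')
    (subset_of_induce_connected hL'.2.1 (fun u hu w hw => hL.2.2 u hu w (hL'.1 hw)) hv' hv)

theorem IsPathSet.of_subset {V : Type} {G : SimpleGraph V} {L X : Set V} (hL : IsPathSet G L)
    (hXL : X ⊆ L) (hX : (G.induce X).Connected) : IsPathSet G X := by
  classical
  obtain ⟨n, ⟨e⟩⟩ := hL
  let idx : X → ℕ := fun v => (e ⟨v, hXL v.2⟩).val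
  have hidx : Function.Injective idx := fun v w h => by
    have := e.injective (Fin.ext h)
    exact Subtype.ext (Subtype.mk.inj this)
  have hadj : ∀ v w : X, (G.induce X).Adj v w ↔ idx v + 1 = idx w ∨ idx w + 1 = idx v := by
    intro v w
    rw [← SimpleGraph.pathGraph_adj, e.map_adj_iff]
    rfl
  have hbound : ∀ v, idx v < n + 1 := fun v => (e _).2
  obtain ⟨v₀⟩ := hX.nonempty
  have hex : ∃ k, ∃ v, idx v = k := ⟨_, v₀, rfl⟩
  obtain ⟨a, ha⟩ := Nat.find_spec hex
  have hmin : ∀ v, idx a ≤ idx v := fun v => by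
    rw [ha]; exact Nat.find_min' hex ⟨v, rfl⟩
  have hfin : (Set.range idx).Finite :=
    (Set.finite_lt_nat (n + 1)).subset (by rintro _ ⟨v, rfl⟩; exact hbound v)
  obtain ⟨_, ⟨b, rfl⟩, hb⟩ := hfin.exists_maximal ⟨_, v₀, rfl⟩
  have hmax : ∀ v, idx v ≤ idx b := fun v => by
    rcases le_total (idx v) (idx b) with h | h
    · exact h
    · exact hb ⟨v, rfl⟩ h
  have hsurj : ∀ k, idx a ≤ k → k ≤ idx b → ∃ v, idx v = k := by
    intro k hak hkb
    by_contra! hk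
    have hab := hk a
    have hbk := hk b
    have := subset_of_induce_connected (L := {v | ∃ h : v ∈ X, idx ⟨v, h⟩ < k}) hX (by
      rintro u ⟨hu, huk⟩ v hv huv
      refine ⟨hv, ?_⟩
      have := (hadj ⟨u, hu⟩ ⟨v, hv⟩).mp huv
      have := hk ⟨v, hv⟩
      omega) a.2 ⟨a.2, show idx a < k by omega⟩ b.2
    obtain ⟨_, hlt⟩ := this
    have : idx b < k := hlt
    omega
  let g : X → Fin (idx b - idx a + 1) := fun v =>
    ⟨idx v - idx a, by have := hmin v; have := hmax v; omega⟩
  have hg : Function.Bijective g := by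
    constructor
    · intro v w h
      have h' : idx v - idx a = idx w - idx a := congrArg Fin.val h
      have := hmin v
      have := hmin w
      exact hidx (by omega)
    · intro k
      obtain ⟨v, hv⟩ := hsurj (idx a + k) (by omega) (by have := k.2; have := hmin b; omega)
      exact ⟨v, Fin.ext (show idx v - idx a = k by omega)⟩
  refine ⟨idx b - idx a, ⟨⟨Equiv.ofBijective g hg, ?_⟩⟩⟩
  intro v w
  rw [hadj, SimpleGraph.pathGraph_adj]
  have := hmin v
  have := hmin w
  change (idx v - idx a + 1 = idx w - idx a ∨ idx w - idx a + 1 = idx v - idx a) ↔ _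
  omega

/-- The set of interior vertices of a walk. -/
def walkInterior {V : Type} {G : SimpleGraph V} {x y : V} (p : G.Walk x y) : Set V :=
  {v | v ∈ p.support ∧ v ≠ x ∧ v ≠ y}

theorem walkInterior_reverse {V : Type} {G : SimpleGraph V} {x y : V} (p : G.Walk x y) :
    walkInterior p.reverse = walkInterior p := by
  ext v
  simp only [walkInterior, SimpleGraph.Walk.support_reverse, List.mem_reverse, Set.mem_ofPred_eq]
  tauto

theorem walkInterior_connected {V : Type} {G : SimpleGraph V} {x y : V} {p : G.Walk x y}
    (hp : p.IsPath) (hne : x ≠ y) (hadj : ¬ G.Adj x y) :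
    (G.induce (walkInterior p)).Connected := by
  cases p with
  | nil => exact absurd rfl hne
  | @cons _ v _ h q =>
    rw [SimpleGraph.Walk.cons_isPath_iff] at hp
    have hq : ¬ q.Nil := fun hn => hadj (hn.eq ▸ h)
    have hs := SimpleGraph.Walk.support_dropLast_concat hq
    have hnd := hp.1.support_nodup
    rw [← hs] at hnd
    have : walkInterior (SimpleGraph.Walk.cons h q) = {w | w ∈ q.dropLast.support} := by
      ext w
      have hw : w ∈ q.support ↔ w ∈ q.dropLast.support ∨ w = y := by rw [← hs]; simp
      have hy : y ∉ q.dropLast.support := by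
        intro hy
        rw [List.nodup_append] at hnd
        exact hnd.2.2 y hy y (by simp) rfl
      have hx := hp.2
      simp only [walkInterior, SimpleGraph.Walk.support_cons, List.mem_cons, Set.mem_ofPred_eq]
      constructor
      · tauto
      · intro h'
        refine ⟨Or.inr (hw.mpr (Or.inl h')), ?_, ?_⟩
        · rintro rfl; exact hx (hw.mpr (Or.inl h'))
        · rintro rfl; exact hy h'
    rw [this]
    exact q.dropLast.connected_induce_support

theorem IsRoute.reverse {V : Type} {G : SimpleGraph V} {W S : Set V} {x y : V} {p : G.Walk x y}
    (h : IsRoute G W S p) : IsRoute G W S p.reverse where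
  ne := h.ne.symm
  isPath := h.isPath.reverse
  induced u v hu hv huv := by
    rw [SimpleGraph.Walk.toSubgraph_reverse]
    simp only [SimpleGraph.Walk.support_reverse, List.mem_reverse] at hu hv
    exact h.induced u v hu hv huv
  support_mem v hv := h.support_mem v (by simpa using hv)
  fst_mem := h.snd_mem
  snd_mem := h.fst_mem
  interior v hv hx hy := h.interior v (by simpa using hv) hy hx

theorem IsRoute.interior_connected {V : Type} {G : SimpleGraph V} {W S : Set V} {x y : V}
    {p : G.Walk x y} (h : IsRoute G W S p) (hS : ∀ x ∈ S, ∀ y ∈ S, ¬ G.Adj x y) :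
    (G.induce (walkInterior p)).Connected :=
  walkInterior_connected h.isPath h.ne (hS x h.fst_mem y h.snd_mem)

theorem IsRoute.exists_adj_interior {V : Type} {G : SimpleGraph V} {W S : Set V} {x y z : V}
    {p : G.Walk x y} (h : IsRoute G W S p) (hS : ∀ x ∈ S, ∀ y ∈ S, ¬ G.Adj x y) (hz : z ∈ S) :
    (∃ v ∈ p.support, G.Adj z v) ↔ ∃ v ∈ walkInterior p, G.Adj z v := by
  constructor
  · rintro ⟨v, hv, hzv⟩
    refine ⟨v, ⟨hv, ?_, ?_⟩, hzv⟩
    · rintro rfl; exact hS z hz v h.fst_mem hzv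
    · rintro rfl; exact hS z hz v h.snd_mem hzv
  · rintro ⟨v, hv, hzv⟩
    exact ⟨v, hv.1, hzv⟩

/-- The constellation determined by a set `A ⊆ S` and a subpath `P L` of each path `L ∈ I`. -/
theorem IsConstellationOn.subfamily {V : Type} {G : SimpleGraph V} {S : Set V}
    (hS : IsConstellationOn G Set.univ S) {A : Finset V} {I : Finset (Set V)}
    {P : Set V → Set V} (hA : (A : Set V) ⊆ S) (hI : ∀ L ∈ I, L ∈ CompsOn G (Set.univ \ S))
    (hP : ∀ L ∈ I, P L ⊆ L)
    (hD : Dominated (fun z X => ∃ v ∈ X, G.Adj z v) (fun X => (G.induce X).Connected) A I P) :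
    ∃ W : Set V, IsConstellationOn G W A ∧ SitsIn G W A Set.univ S ∧
      (CompsOn G (W \ A)).ncard = I.card ∧
      ∀ (x y : V) (p : G.Walk x y), IsRoute G W A p →
        IsRoute G Set.univ S p ∧ ∃ L ∈ I, walkInterior p ⊆ P L := by
  have hcomp := fun L hL => mem_compsOn_iff.mp (hI L hL)
  set U : Set V := ⋃ L ∈ I, P L with hU
  have hmemU : ∀ v, v ∈ U ↔ ∃ L ∈ I, v ∈ P L := fun v => by simp [hU]
  have hUS : ∀ v ∈ U, v ∉ S := fun v hv => by
    obtain ⟨L, hL, hvL⟩ := (hmemU v).mp hv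
    exact ((hcomp L hL).1 (hP L hL hvL)).2
  have hWU : ((A : Set V) ∪ U) \ A = U := by
    ext v
    have := fun h : v ∈ (A : Set V) => hA h
    have := hUS v
    simp only [Set.mem_sdiff, Set.mem_union]
    tauto
  have hclosed : ∀ L ∈ I, ∀ u ∈ P L, ∀ v ∈ U, G.Adj u v → v ∈ P L := by
    intro L hL u hu v hv huv
    obtain ⟨L', hL', hvL'⟩ := (hmemU v).mp hv
    have hvL : v ∈ L := (hcomp L hL).2.2 u (hP L hL hu) v ⟨trivial, hUS v hv⟩ huv
    rwa [eq_of_mem_compsOn (hI L hL) (hI L' hL') hvL (hP L' hL' hvL')]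
  have hcomps : CompsOn G U = P '' I := by
    ext M
    rw [mem_compsOn_iff]
    constructor
    · rintro ⟨hMU, hM, hMcl⟩
      obtain ⟨v, hv⟩ := hM.nonempty
      obtain ⟨L, hL, hvL⟩ := (hmemU v).mp (hMU hv)
      refine ⟨L, hL, subset_antisymm ?_ ?_⟩
      · exact subset_of_induce_connected (hD L hL).1
          (fun u hu w hw => hMcl u hu w ((hmemU w).mpr ⟨L, hL, hw⟩)) hvL hv
      · exact subset_of_induce_connected hM (fun u hu w hw => hclosed L hL u hu w (hMU hw)) hv hvL
    · rintro ⟨L, hL, rfl⟩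
      exact ⟨fun v hv => (hmemU v).mpr ⟨L, hL, hv⟩, (hD L hL).1, hclosed L hL⟩
  have hPL : ∀ L ∈ I, ∀ M ∈ CompsOn G (Set.univ \ S), P L ⊆ M → L = M := by
    intro L hL M hM hLM
    obtain ⟨v, hv⟩ := (hD L hL).1.nonempty
    exact eq_of_mem_compsOn (hI L hL) hM (hP L hL hv) (hLM hv)
  refine ⟨A ∪ U, ⟨Set.subset_union_left, fun x hx y hy => hS.stable x (hA hx) y (hA hy), ?_, ?_⟩,
    ⟨Set.subset_univ _, hA, ?_, ?_⟩, ?_, ?_⟩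
  · rw [hWU, hcomps]
    rintro _ ⟨L, hL, rfl⟩
    exact (hS.comp_paths L (hI L hL)).of_subset (hP L hL) (hD L hL).1
  · rw [hWU, hcomps]
    rintro x hx _ ⟨L, hL, rfl⟩
    exact (hD L hL).2 x hx
  · rw [hWU, hcomps]
    rintro _ ⟨L, hL, rfl⟩
    exact ⟨L, hI L hL, hP L hL⟩
  · rw [hWU, hcomps]
    rintro M hM _ ⟨L₁, hL₁, rfl⟩ _ ⟨L₂, hL₂, rfl⟩ h₁ h₂
    rw [hPL L₁ hL₁ M hM h₁, hPL L₂ hL₂ M hM h₂]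
  · rw [hWU, hcomps, Set.InjOn.ncard_image, Set.ncard_coe_finset]
    intro L₁ hL₁ L₂ hL₂ h
    exact hPL L₁ hL₁ L₂ (hI L₂ hL₂) (h ▸ hP L₂ hL₂)
  · intro x y p hp
    have hint : walkInterior p ⊆ U := fun v hv =>
      (hp.support_mem v hv.1).resolve_left (hp.interior v hv.1 hv.2.1 hv.2.2)
    refine ⟨⟨hp.ne, hp.isPath, hp.induced, fun _ _ => trivial, hA hp.fst_mem, hA hp.snd_mem,
      fun v hv hx hy => hUS v (hint ⟨hv, hx, hy⟩)⟩, ?_⟩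
    have hc := hp.interior_connected (fun x hx y hy => hS.stable x (hA hx) y (hA hy))
    obtain ⟨v, hv⟩ := hc.nonempty
    obtain ⟨L, hL, hvL⟩ := (hmemU v).mp (hint hv)
    exact ⟨L, hL, subset_of_induce_connected hc
      (fun u hu w hw => hclosed L hL u hu w (hint hw)) hv hvL⟩

theorem mem_support_induce_iff {V : Type} {G : SimpleGraph V} {X : Set V} {x y : V}
    (p : G.Walk x y) (hp : ∀ v ∈ p.support, v ∈ X) {u : X} :
    u ∈ (p.induce X hp).support ↔ (u : V) ∈ p.support := by
  rw [SimpleGraph.Walk.support_induce]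
  simp

theorem toSubgraph_adj_induce {V : Type} {G : SimpleGraph V} {X : Set V} {x y : V}
    (p : G.Walk x y) (hp : ∀ v ∈ p.support, v ∈ X) {u v : X} (h : p.toSubgraph.Adj u v) :
    (p.induce X hp).toSubgraph.Adj u v := by
  have hm := congrArg SimpleGraph.Walk.edges (SimpleGraph.Walk.map_induce p hp)
  have hm' := (SimpleGraph.Walk.edges_map _ _).symm.trans hm
  rw [SimpleGraph.Walk.adj_toSubgraph_iff_mem_edges] at h ⊢
  obtain ⟨e, he, heq⟩ := List.mem_map.mp (hm'.symm ▸ h)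
  have : e = s(u, v) := Sym2.map.injective Subtype.val_injective heq
  exact this ▸ he

theorem support_induce_map_val {V : Type} {G : SimpleGraph V} {X : Set V} {x y : V}
    (p : G.Walk x y) (hp : ∀ v ∈ p.support, v ∈ X) :
    (p.induce X hp).support.map Subtype.val = p.support := by
  rw [SimpleGraph.Walk.support_induce]
  simp

theorem isPath_induce {V : Type} {G : SimpleGraph V} {X : Set V} {x y : V}
    {p : G.Walk x y} (h : p.IsPath) (hp : ∀ v ∈ p.support, v ∈ X) : (p.induce X hp).IsPath := by
  refine SimpleGraph.Walk.IsPath.mk' (List.Nodup.of_map Subtype.val ?_)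
  rw [support_induce_map_val]
  exact h.support_nodup

theorem induce_eq_reverse {V : Type} {G : SimpleGraph V} {X : Set V} {x y : V}
    {p : G.Walk x y} {p' : G.Walk y x} (h : p' = p.reverse) (hp : ∀ v ∈ p.support, v ∈ X)
    (hp' : ∀ v ∈ p'.support, v ∈ X) : p'.induce X hp' = (p.induce X hp).reverse := by
  apply SimpleGraph.Walk.ext_support
  apply List.map_injective_iff.mpr Subtype.val_injective
  rw [SimpleGraph.Walk.support_reverse, List.map_reverse, support_induce_map_val,
    support_induce_map_val, h, SimpleGraph.Walk.support_reverse]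

theorem exists_isSubdivisionWith_of_routes {V W : Type} {G : SimpleGraph V} {S : Set V}
    (hS : ∀ x ∈ S, ∀ y ∈ S, ¬ G.Adj x y) (b : W → V) (hb : Function.Injective b)
    (hbS : ∀ w, b w ∈ S) (p : ∀ u v, u ≠ v → G.Walk (b u) (b v))
    (hroute : ∀ u v h, IsRoute G Set.univ S (p u v h))
    (hsymm : ∀ u v (h : u ≠ v), p v u h.symm = (p u v h).reverse)
    (hfree : ∀ u v h w, w ≠ u → w ≠ v → ∀ z ∈ walkInterior (p u v h), ¬ G.Adj (b w) z)
    (hanti : ∀ u v h u' v' h', s(u, v) ≠ s(u', v') →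
      Anticomplete G (walkInterior (p u v h)) (walkInterior (p u' v' h'))) :
    ∃ X : Set V, IsSubdivisionWith (G.induce X) (⊤ : SimpleGraph W) (fun n => 2 ≤ n) := by
  let X : Set V := Set.range b ∪ {x | ∃ u v h, x ∈ walkInterior (p u v h)}
  have hbX : ∀ w, b w ∈ X := fun w => Or.inl ⟨w, rfl⟩
  have hsub : ∀ u v h, ∀ x ∈ (p u v h).support, x ∈ X := by
    intro u v h x hx
    by_cases hu : x = b u
    · exact hu ▸ hbX u
    by_cases hv : x = b v
    · exact hv ▸ hbX v
    exact Or.inr ⟨u, v, h, hx, hu, hv⟩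
  have hedge : ∀ x ∈ X, ∀ y ∈ X, G.Adj x y → ∃ u v h, x ∈ (p u v h).support ∧
      y ∈ (p u v h).support := by
    have hmix : ∀ w u v h, ∀ y ∈ walkInterior (p u v h), G.Adj (b w) y →
        b w ∈ (p u v h).support ∧ y ∈ (p u v h).support := by
      intro w u v h y hy hadj
      refine ⟨?_, hy.1⟩
      by_cases hu : w = u
      · exact hu ▸ (p u v h).start_mem_support
      by_cases hv : w = v
      · exact hv ▸ (p u v h).end_mem_support
      exact absurd hadj (hfree u v h w hu hv y hy)
    rintro x (⟨w, rfl⟩ | ⟨u, v, h, hx⟩) y (⟨w', rfl⟩ | ⟨u', v', h', hy⟩) hadj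
    · exact absurd hadj (hS _ (hbS _) _ (hbS _))
    · exact ⟨u', v', h', hmix w u' v' h' y hy hadj⟩
    · exact ⟨u, v, h, (hmix w' u v h x hx hadj.symm).symm⟩
    · by_cases heq : s(u, v) = s(u', v')
      · refine ⟨u, v, h, hx.1, ?_⟩
        rw [Sym2.eq_iff] at heq
        rcases heq with ⟨rfl, rfl⟩ | ⟨rfl, rfl⟩
        · exact hy.1
        · have := hy.1
          rw [hsymm u v h] at this
          simpa using this
      · exact absurd hadj ((hanti u v h u' v' h' heq).2 x hx y hy)
  refine ⟨X, ⟨{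
    b := fun w => ⟨b w, hbX w⟩
    b_inj := fun u v h => hb (Subtype.mk.inj h)
    path := fun u v h => (p u v h.ne).induce X (hsub u v h.ne)
    path_isPath := fun u v h => isPath_induce (hroute u v h.ne).isPath _
    path_len := ?_
    path_symm := ?_
    branch_avoid := ?_
    interiors_anticomplete := ?_
    cover := ?_
    edges_eq := ?_ }⟩⟩
  · intro u v h
    have hlen : ∀ q : (G.induce X).Walk ⟨b u, hbX u⟩ ⟨b v, hbX v⟩, 2 ≤ q.length := by
      intro q
      by_contra! hlt
      rcases Nat.lt_or_ge q.length 1 with h0 | h1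
      · have := SimpleGraph.Walk.eq_of_length_eq_zero (p := q) (by omega)
        exact h.ne (hb (Subtype.mk.inj this))
      · have := SimpleGraph.Walk.adj_of_length_eq_one (p := q) (by omega)
        exact hS _ (hbS u) _ (hbS v) this
    exact hlen _
  · exact fun u v h => induce_eq_reverse (hsymm u v h.ne) _ _
  · intro u v h w hw
    rw [mem_support_induce_iff] at hw
    by_contra! hne
    exact (hroute u v h.ne).interior _ hw (fun h' => hne.1 (hb h')) (fun h' => hne.2 (hb h'))
      (hbS w)
  · intro u v u' v' h h' hne x hx hxu hxv y hy hyu hyv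
    rw [mem_support_induce_iff] at hx hy
    have hA := hanti u v h.ne u' v' h'.ne hne
    have hx' : (x : V) ∈ walkInterior (p u v h.ne) :=
      ⟨hx, fun e => hxu (Subtype.ext e), fun e => hxv (Subtype.ext e)⟩
    have hy' : (y : V) ∈ walkInterior (p u' v' h'.ne) :=
      ⟨hy, fun e => hyu (Subtype.ext e), fun e => hyv (Subtype.ext e)⟩
    refine ⟨?_, hA.2 x hx' y hy'⟩
    rintro rfl
    exact Set.disjoint_left.mp hA.1 hx' hy'
  · rintro ⟨x, ⟨w, rfl⟩ | ⟨u, v, h, hx⟩⟩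
    · exact Or.inl ⟨w, rfl⟩
    · exact Or.inr ⟨u, v, h, (mem_support_induce_iff _ _).mpr hx.1⟩
  · intro x y hxy
    obtain ⟨u, v, h, hx, hy⟩ := hedge x x.2 y y.2 hxy
    exact ⟨u, v, h, toSubgraph_adj_induce _ _ ((hroute u v h).induced x y hx hy hxy)⟩

theorem anticomplete_of_subset_comps {V : Type} {G : SimpleGraph V} {U L L' X X' : Set V}
    (hL : L ∈ CompsOn G U) (hL' : L' ∈ CompsOn G U) (hne : L ≠ L') (hX : X ⊆ L) (hX' : X' ⊆ L') :
    Anticomplete G X X' := by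
  have hdisj : ∀ v ∈ L, v ∉ L' := fun v hv hv' => hne (eq_of_mem_compsOn hL hL' hv hv')
  rw [mem_compsOn_iff] at hL hL'
  exact ⟨Set.disjoint_left.mpr fun v hv hv' => hdisj v (hX hv) (hX' hv'), fun x hx y hy hxy =>
    hdisj y (hL.2.2 x (hX hx) y (hL'.1 (hX' hy)) hxy) (hX' hy)⟩

/-- The graph-theoretic route relation: `X` is the interior of a route from `x` to `y`. -/
def IsRouteInterior {V : Type} (G : SimpleGraph V) (S : Set V) (x y : V) (X : Set V) : Prop :=
  ∃ p : G.Walk x y, IsRoute G Set.univ S p ∧ X = walkInterior p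

theorem IsRouteInterior.symm {V : Type} {G : SimpleGraph V} {S : Set V} {x y : V} {X : Set V}
    (h : IsRouteInterior G S x y X) : IsRouteInterior G S y x X := by
  obtain ⟨p, hp, rfl⟩ := h
  exact ⟨p.reverse, hp.reverse, (walkInterior_reverse p).symm⟩

theorem FamilyClique.exists_subdivision {V : Type} {G : SimpleGraph V} {S : Set V}
    (hS : ∀ x ∈ S, ∀ y ∈ S, ¬ G.Adj x y) {k : ℕ} {A : Finset V} {I : Finset (Set V)}
    (hA : (A : Set V) ⊆ S) (hI : ∀ L ∈ I, L ∈ CompsOn G (Set.univ \ S))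
    (h : FamilyClique (fun z X => ∃ v ∈ X, G.Adj z v) (IsRouteInterior G S) k A I id) :
    ∃ X : Set V, IsSubdivisionWith (G.induce X) (⊤ : SimpleGraph (Fin k)) (fun n => 2 ≤ n) := by
  obtain ⟨B, hBA, hBk, f, hf, φ, X, hX, hφ⟩ := h
  let e := (B.equivFinOfCardEq hBk).symm
  let b : Fin k → V := fun i => e i
  have hbB : ∀ i, b i ∈ B := fun i => (e i).2
  have hb : Function.Injective b := Subtype.val_injective.comp e.injective
  have hlt : ∀ u v, u ≠ v → ¬ f (b u) < f (b v) → f (b v) < f (b u) := by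
    intro u v huv hn
    exact lt_of_le_of_ne (not_lt.mp hn) fun h => huv (hb (hf (hbB u) (hbB v) h.symm))
  have hwalk : ∀ u v, ∃ p : f (b u) < f (b v) → G.Walk (b u) (b v), ∀ h,
      IsRoute G Set.univ S (p h) ∧ X (b u) (b v) = walkInterior (p h) := by
    intro u v
    by_cases h : f (b u) < f (b v)
    · obtain ⟨p, hp⟩ := (hX _ (hbB u) _ (hbB v) h).2.2.1
      exact ⟨fun _ => p, fun _ => hp⟩
    · exact ⟨fun h' => absurd h' h, fun h' => absurd h' h⟩
  choose p hp using hwalk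
  let P : ∀ u v, u ≠ v → G.Walk (b u) (b v) := fun u v h =>
    if h' : f (b u) < f (b v) then p u v h' else (p v u (hlt u v h h')).reverse
  have hP : ∀ u v h, f (b u) < f (b v) ∧ IsRoute G Set.univ S (P u v h) ∧
        walkInterior (P u v h) = X (b u) (b v) ∨
      f (b v) < f (b u) ∧ IsRoute G Set.univ S (P u v h) ∧
        walkInterior (P u v h) = X (b v) (b u) := by
    intro u v h
    by_cases h' : f (b u) < f (b v)
    · have : P u v h = p u v h' := dif_pos h'
      rw [this]
      exact Or.inl ⟨h', (hp u v h').1, (hp u v h').2.symm⟩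
    · have : P u v h = (p v u (hlt u v h h')).reverse := dif_neg h'
      rw [this, walkInterior_reverse]
      have := hp v u (hlt u v h h')
      exact Or.inr ⟨hlt u v h h', this.1.reverse, this.2.symm⟩
  have hP' : ∀ u v h, ∃ x y, s(x, y) = s(u, v) ∧ f (b x) < f (b y) ∧
      walkInterior (P u v h) = X (b x) (b y) := by
    intro u v h
    rcases hP u v h with ⟨h₁, -, h₂⟩ | ⟨h₁, -, h₂⟩
    · exact ⟨u, v, rfl, h₁, h₂⟩
    · exact ⟨v, u, Sym2.eq_swap, h₁, h₂⟩
  refine exists_isSubdivisionWith_of_routes hS b hb (fun w => hA (hBA (hbB w))) P ?_ ?_ ?_ ?_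
  · intro u v h
    rcases hP u v h with h | h <;> exact h.2.1
  · intro u v h
    by_cases h' : f (b u) < f (b v)
    · have h₁ : P u v h = p u v h' := dif_pos h'
      have h₂ : P v u h.symm = (p u v _).reverse := dif_neg h'.not_gt
      rw [h₁, h₂]
    · have h₁ : P u v h = (p v u (hlt u v h h')).reverse := dif_neg h'
      have h₂ : P v u h.symm = p v u _ := dif_pos (hlt u v h h')
      rw [h₁, h₂, SimpleGraph.Walk.reverse_reverse]
  · intro u v h w hwu hwv z hz hadj
    obtain ⟨x, y, hxy, hlt, hint⟩ := hP' u v h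
    have hw : w ≠ x ∧ w ≠ y := by
      rcases Sym2.eq_iff.mp hxy with ⟨rfl, rfl⟩ | ⟨rfl, rfl⟩
      · exact ⟨hwu, hwv⟩
      · exact ⟨hwv, hwu⟩
    exact (hX _ (hbB x) _ (hbB y) hlt).2.2.2 _ (hbB w) (hb.ne hw.1) (hb.ne hw.2)
      ⟨z, hint ▸ hz, hadj⟩
  · intro u v h u' v' h' hne
    obtain ⟨x, y, hxy, hlt, hint⟩ := hP' u v h
    obtain ⟨x', y', hxy', hlt', hint'⟩ := hP' u' v' h'
    obtain ⟨hL, hXL, -⟩ := hX _ (hbB x) _ (hbB y) hlt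
    obtain ⟨hL', hXL', -⟩ := hX _ (hbB x') _ (hbB y') hlt'
    rw [hint, hint']
    refine anticomplete_of_subset_comps (hI _ hL) (hI _ hL') (fun heq => hne ?_) hXL hXL'
    obtain ⟨h₁, h₂⟩ := hφ _ (hbB x) _ (hbB y) _ (hbB x') _ (hbB y') hlt hlt' heq
    rw [← hxy, ← hxy', hb h₁, hb h₂]

/-- Lemma 5.3: for all positive `l, l', s, s', t` and every `σ ∈ ℕ`,
there are `f, g` such that for all `q ≥ 1` and `q⁻ + q⁺ = σ`, every ample
`(q⁻,q,q⁺)`-mixed `(f,g)`-constellation contains a proper subdivision of `K_{2t+2}` as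
an induced subgraph, or an interrupted `(s,l)`-constellation sits in it, or a
`q`-zigzagged `(s',l')`-constellation sits in it. -/
theorem stmt9 (l l' s s' t σ : ℕ)
    (hl : 0 < l) (hl' : 0 < l') (hs : 0 < s) (hs' : 0 < s') (ht : 0 < t) :
    ∃ f g : ℕ, 0 < f ∧ 0 < g ∧
      ∀ (q qm qp : ℕ), 0 < q → qm + qp = σ →
      ∀ (V : Type) [Fintype V] (G : SimpleGraph V) (S : Set V),
        IsConstellationOn G Set.univ S →
        DAmple G Set.univ S 1 →
        Mixed G Set.univ S qm q qp →
        S.ncard = f → (CompsOn G (Set.univ \ S)).ncard = g →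
          (∃ X : Set V,
              IsSubdivisionWith (G.induce X) (⊤ : SimpleGraph (Fin (2 * t + 2)))
                (fun n => 2 ≤ n)) ∨
          (∃ W' S' : Set V, IsConstellationOn G W' S' ∧ SitsIn G W' S' Set.univ S ∧
              Interrupted G W' S' ∧
              S'.ncard = s ∧ (CompsOn G (W' \ S')).ncard = l) ∨
          (∃ W' S' : Set V, IsConstellationOn G W' S' ∧ SitsIn G W' S' Set.univ S ∧
              Zigzagged G W' S' q ∧
              S'.ncard = s' ∧ (CompsOn G (W' \ S')).ncard = l') := by
  classical
  obtain ⟨F, Γ, h⟩ := exists_familyOutcome (2 * t + 2) s l s' l' σ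
  refine ⟨F + 1, Γ + 1, Nat.succ_pos _, Nat.succ_pos _, ?_⟩
  intro q qm qp _ hσ V _ G S hS _ hM hSc hLc
  obtain ⟨f, hf, hM⟩ := hM
  have hst : ∀ x ∈ S, ∀ y ∈ S, ¬ G.Adj x y := fun x hx y hy => hS.stable x hx y hy
  set A : Finset V := S.toFinset with hA
  have hAS : (A : Set V) = S := Set.coe_toFinset S
  set I : Finset (Set V) := (CompsOn G (Set.univ \ S)).toFinset with hI
  have hIL : ∀ L ∈ I, L ∈ CompsOn G (Set.univ \ S) := fun L hL => Set.mem_toFinset.mp hL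
  have hsub : ∀ B : Finset V, B ⊆ A → (B : Set V) ⊆ S := fun B hB => hAS ▸ Finset.coe_subset.mpr hB
  have hAc : A.card = F + 1 := by rw [← hSc, ← hAS, Set.ncard_coe_finset]
  have hIc : I.card = Γ + 1 := by
    rw [← hLc, ← Set.coe_toFinset (CompsOn G (Set.univ \ S)), Set.ncard_coe_finset]
  have hmix : FamilyMixed (fun z X => ∃ v ∈ X, G.Adj z v) (IsRouteInterior G S)
      f A I id qm q qp := by
    rintro x hx y hy hxy L hL _ hXL ⟨p, hp, rfl⟩ Qm hQm Q hQ Qp hQp hm hq hpc h₁ h₂ h₃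
    obtain ⟨z, hz, hzp⟩ := hM x (hsub A subset_rfl hx) y (hsub A subset_rfl hy) hxy p hp Qm Q Qp
      (hsub Qm hQm) (hsub Q hQ) (hsub Qp hQp) (by rw [Set.ncard_coe_finset, hm])
      (by rw [Set.ncard_coe_finset, hq]) (by rw [Set.ncard_coe_finset, hpc]) h₁ h₂ h₃
    have hzS : z ∈ S := by
      rcases hz with (hz | hz) | hz
      exacts [hsub Qm hQm hz, hsub Q hQ hz, hsub Qp hQp hz]
    exact ⟨z, or_assoc.mp hz, (hp.exists_adj_interior hst hzS).mp hzp⟩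
  rcases h q qm qp hσ (fun z X => ∃ v ∈ X, G.Adj z v) (IsRouteInterior G S)
      (fun X => (G.induce X).Connected)
      (fun x y X ⟨p, hp, hX⟩ => hX ▸ hp.interior_connected hst) (fun x y X => IsRouteInterior.symm)
      (fun z X Y hXY ⟨v, hv, hzv⟩ => ⟨v, hXY hv, hzv⟩) f A I id (hAS ▸ hf) (by omega) (by omega)
      (fun L hL => ⟨(mem_compsOn_iff.mp (hIL L hL)).2.1, fun a ha =>
        hS.dominates a (hsub A subset_rfl ha) L (hIL L hL)⟩) hmix with hC | hC | hC
  · exact Or.inl (hC.exists_subdivision hst hAS.subset hIL)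
  · obtain ⟨A', hA', I', hI', P', hP', hD, rfl, rfl, g, hg, hC⟩ := hC
    obtain ⟨W, hW, hsit, hcard, hroute⟩ :=
      hS.subfamily (hsub A' hA') (fun L hL => hIL L (hI' hL)) hP' hD
    refine Or.inr (Or.inl ⟨W, A', hW, hsit, ⟨g, hg, ?_⟩, Set.ncard_coe_finset A', hcard⟩)
    intro x hx y hy z hz hxy hyz p hp
    obtain ⟨hr, L, hL, hpL⟩ := hroute x y p hp
    exact (hr.exists_adj_interior hst (hsub A' hA' hz)).mpr
      (hC x hx y hy z hz hxy hyz L hL _ hpL ⟨p, hr, rfl⟩)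
  · obtain ⟨A', hA', I', hI', P', hP', hD, rfl, rfl, g, hg, hC⟩ := hC
    obtain ⟨W, hW, hsit, hcard, hroute⟩ :=
      hS.subfamily (hsub A' hA') (fun L hL => hIL L (hI' hL)) hP' hD
    refine Or.inr (Or.inr ⟨W, A', hW, hsit, ⟨g, hg, ?_⟩, Set.ncard_coe_finset A', hcard⟩)
    intro x hx y hy hxy p hp
    obtain ⟨hr, L, hL, hpL⟩ := hroute x y p hp
    refine (Set.ncard_le_ncard ?_ (Set.toFinite _)).trans_lt
      (hC x hx y hy hxy L hL _ hpL ⟨p, hr, rfl⟩)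
    rintro z ⟨hz, hxz, hzy, hn⟩
    exact ⟨hz, hxz, hzy, fun h' => hn ((hr.exists_adj_interior hst (hsub A' hA' hz)).mpr h')⟩
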